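/- There exists a sequence $(u_m)_{m\ge1}$ in $H\setminus\{0\}$ of critical points of $I$ (i.e. the Fréchet derivative $DI(u_m)$ is the zero functional for every $m$) such that $I(u_m)\to+\infty$; consequently the energies $\int_\Omega|Tu_m|^{q+1}\,d\mu$ tend to $+\infty$, and in particular $I$ has infinitely many distinct nonzero critical points. -/

import Mathlib

open MeasureTheory Filter Topology

/-- The mod 2 simplicial coboundary of a cochain on finite sequences, evaluated at a sequence. -/
def cobd {X : Type*} : List X → (List X → ZMod 2) → ZMod 2
  | [], _ => 0
  | x :: l, φ => φ l + cobd l (fun l' => φ (x :: l'))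

/-- The dual of the mod 2 prism operator between two maps `f` and `g`. -/
def prism {X : Type*} (f g : X → X) : List X → (List X → ZMod 2) → ZMod 2
  | [], _ => 0
  | x :: l, φ => φ (f x :: g x :: l.map g) + prism f g l (fun l' => φ (f x :: l'))

section Cochains

variable {X : Type*}

lemma zmod_two_add_self (a : ZMod 2) : a + a = 0 := CharTwo.add_self_eq_zero a

lemma cobd_add (l : List X) (φ ψ : List X → ZMod 2) :
    cobd l (fun l' => φ l' + ψ l') = cobd l φ + cobd l ψ := by
  induction l generalizing φ ψ with
  | nil => simp [cobd]
  | cons x l ih => simp only [cobd, ih]; ring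

lemma cobd_const_mul (l : List X) (a : ZMod 2) (φ : List X → ZMod 2) :
    cobd l (fun l' => a * φ l') = a * cobd l φ := by
  induction l generalizing φ with
  | nil => simp [cobd]
  | cons x l ih => simp only [cobd, ih]; ring

lemma cobd_map (g : X → X) (l : List X) (φ : List X → ZMod 2) :
    cobd (l.map g) φ = cobd l (fun l' => φ (l'.map g)) := by
  induction l generalizing φ with
  | nil => simp [cobd]
  | cons x l ih => simp only [cobd, List.map_cons, ih]

lemma cobd_cobd (l : List X) (φ : List X → ZMod 2) : cobd l (fun l' => cobd l' φ) = 0 := by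
  induction l generalizing φ with
  | nil => simp [cobd]
  | cons x l ih =>
    simp only [cobd, cobd_add, ih]
    rw [add_zero, zmod_two_add_self]

lemma prism_add (f g : X → X) (l : List X) (φ ψ : List X → ZMod 2) :
    prism f g l (fun l' => φ l' + ψ l') = prism f g l φ + prism f g l ψ := by
  induction l generalizing φ ψ with
  | nil => simp [prism]
  | cons x l ih => simp only [prism, ih]; ring

lemma prism_eq_zero (f g : X → X) (l : List X) (φ : List X → ZMod 2)
    (h : ∀ l', (∀ y ∈ l', ∃ x ∈ l, y = f x ∨ y = g x) → φ l' = 0) : prism f g l φ = 0 := by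
  induction l generalizing φ with
  | nil => simp [prism]
  | cons x l ih =>
    rw [prism, h, ih, add_zero]
    · intro l' hl'
      apply h
      intro y hy
      rcases List.mem_cons.1 hy with rfl | hy
      · exact ⟨x, by simp⟩
      · obtain ⟨z, hz, h'⟩ := hl' y hy
        exact ⟨z, by simp [hz], h'⟩
    · intro y hy
      simp only [List.mem_cons, List.mem_map] at hy
      rcases hy with rfl | rfl | ⟨z, hz, rfl⟩
      · exact ⟨x, by simp⟩
      · exact ⟨x, by simp⟩
      · exact ⟨z, by simp [hz]⟩

/-- The prism operator is a chain homotopy between the maps induced by `f` and `g`. -/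
lemma cobd_prism_add_prism_cobd (f g : X → X) (l : List X) (φ : List X → ZMod 2) :
    cobd l (fun l' => prism f g l' φ) + prism f g l (fun l' => cobd l' φ) =
      φ (l.map f) + φ (l.map g) := by
  induction l generalizing φ with
  | nil => simp [cobd, prism, zmod_two_add_self]
  | cons x l ih =>
    simp only [cobd, prism, List.map_cons, cobd_add, prism_add, cobd_map]
    linear_combination ih (fun l' => φ (f x :: l')) + zmod_two_add_self (prism f g l φ)
      + zmod_two_add_self (cobd l fun l' => φ (f x :: g x :: l'.map g))
      + zmod_two_add_self (φ (f x :: l.map g))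

lemma sum_prism (g : ℕ → X → X) (m : ℕ) (l : List X) (φ : List X → ZMod 2) :
    cobd l (fun l' => ∑ j ∈ Finset.range m, prism (g j) (g (j + 1)) l' φ) +
      ∑ j ∈ Finset.range m, prism (g j) (g (j + 1)) l (fun l' => cobd l' φ) =
      φ (l.map (g 0)) + φ (l.map (g m)) := by
  induction m with
  | zero =>
    have := cobd_const_mul l 0 (fun _ => 0)
    simp only [zero_mul] at this
    simp [zmod_two_add_self, this]
  | succ m ih =>
    simp only [Finset.sum_range_succ, cobd_add]
    linear_combination ih + cobd_prism_add_prism_cobd (g m) (g (m + 1)) l φ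
      + zmod_two_add_self (φ (l.map (g m)))

/-- The cup product of the coboundaries of the 0-cochains `s (k - 1), …, s 0`. -/
def cupCobd (s : ℕ → X → ZMod 2) : ℕ → List X → ZMod 2
  | 0, [_] => 1
  | k + 1, x :: y :: l => (s k x + s k y) * cupCobd s k (y :: l)
  | _, _ => 0

/-- The cup product of `s k` with `cupCobd s k`. -/
def zeroCup (s : ℕ → X → ZMod 2) (k : ℕ) : List X → ZMod 2
  | [] => 0
  | x :: l => s k x * cupCobd s k (x :: l)

lemma cupCobd_nil (s : ℕ → X → ZMod 2) (k : ℕ) : cupCobd s k [] = 0 := by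
  cases k <;> simp [cupCobd]

lemma cobd_zeroCup_of_closed (s : ℕ → X → ZMod 2) (k : ℕ)
    (h : ∀ l, cobd l (cupCobd s k) = 0) (l : List X) :
    cobd l (zeroCup s k) = cupCobd s (k + 1) l := by
  match l with
  | [] => simp [cobd, cupCobd]
  | [x] => simp [cobd, zeroCup, cupCobd]
  | x :: y :: l =>
    have h1 := h (x :: y :: l)
    rw [cobd] at h1 ⊢
    simp only [zeroCup, cupCobd, cobd_const_mul]
    linear_combination s k x * h1 - zmod_two_add_self (cupCobd s k (y :: l) * s k x)

lemma cobd_cupCobd (s : ℕ → X → ZMod 2) (k : ℕ) (l : List X) : cobd l (cupCobd s k) = 0 := by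
  induction k generalizing l with
  | zero =>
    match l with
    | [] => simp [cobd]
    | [x] => simp [cobd, cupCobd]
    | [x, y] => simp [cobd, cupCobd, zmod_two_add_self]
    | x :: y :: z :: l =>
      have h0 : ∀ l : List X, cobd l (fun _ => 0) = 0 := fun l => by
        simpa using cobd_const_mul l 0 (fun _ => 0)
      simp [cobd, cupCobd, h0]
  | succ k ih =>
    have : cupCobd s (k + 1) = fun l => cobd l (zeroCup s k) :=
      funext fun l => (cobd_zeroCup_of_closed s k ih l).symm
    rw [this, cobd_cobd]

lemma cobd_zeroCup (s : ℕ → X → ZMod 2) (k : ℕ) (l : List X) :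
    cobd l (zeroCup s k) = cupCobd s (k + 1) l :=
  cobd_zeroCup_of_closed s k (cobd_cupCobd s k) l

lemma cupCobd_map (s : ℕ → X → ZMod 2) (a : X → X) (k : ℕ) (l : List X)
    (h : ∀ x ∈ l, ∀ i, s i (a x) = s i x + 1) : cupCobd s k (l.map a) = cupCobd s k l := by
  induction k generalizing l with
  | zero =>
    match l with
    | [] => simp [cupCobd]
    | [x] => simp [cupCobd]
    | x :: y :: l => simp [cupCobd]
  | succ k ih =>
    match l with
    | [] => simp [cupCobd]
    | [x] => simp [cupCobd]
    | x :: y :: l =>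
      have := ih (y :: l) (fun z hz => h z (by simp [List.mem_cons.1 hz]))
      simp only [List.map_cons, cupCobd] at this ⊢
      rw [this, h x (by simp), h y (by simp)]
      linear_combination cupCobd s k (y :: l) * zmod_two_add_self 1

lemma zeroCup_map (s : ℕ → X → ZMod 2) (a : X → X) (k : ℕ) (l : List X)
    (h : ∀ x ∈ l, ∀ i, s i (a x) = s i x + 1) :
    zeroCup s k l + zeroCup s k (l.map a) = cupCobd s k l := by
  match l with
  | [] => simp [zeroCup, cupCobd_nil]
  | x :: l =>
    have := cupCobd_map s a k (x :: l) h
    simp only [List.map_cons, zeroCup] at this ⊢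
    rw [this, h x (by simp)]
    linear_combination zmod_two_add_self (s k x * cupCobd s k (x :: l))

lemma cupCobd_eq_zero (s : ℕ → X → ZMod 2) (k i : ℕ) (hi : i < k) (l : List X)
    (h : ∀ x ∈ l, ∀ y ∈ l, s i x = s i y) : cupCobd s k l = 0 := by
  induction k generalizing l with
  | zero => omega
  | succ k ih =>
    match l with
    | [] => simp [cupCobd]
    | [x] => simp [cupCobd]
    | x :: y :: l =>
      rw [cupCobd]
      rcases Nat.lt_succ_iff_lt_or_eq.1 hi with h' | rfl
      · rw [ih h', mul_zero]
        exact fun a ha b hb => h a (List.mem_cons_of_mem _ ha) b (List.mem_cons_of_mem _ hb)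
      · rw [h x (by simp) y (by simp), zmod_two_add_self, zero_mul]

end Cochains

section BorsukUlam

variable {E : Type*} [NormedAddCommGroup E] [NormedSpace ℝ E]

/-- The boundary of the cross-polytope with vertices `± e 0, …, ± e k`. -/
def crossSphere (e : ℕ → E) : ℕ → Set E
  | 0 => {e 0, -e 0}
  | k + 1 => (fun z : E × ℝ => (1 - |z.2|) • z.1 + z.2 • e (k + 1)) ''
      (crossSphere e k ×ˢ Set.Icc (-1) 1)

lemma isCompact_crossSphere (e : ℕ → E) (k : ℕ) : IsCompact (crossSphere e k) := by
  induction k with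
  | zero => exact (Set.toFinite {e 0, -e 0}).isCompact
  | succ k ih =>
    refine (ih.prod isCompact_Icc).image ?_
    fun_prop

lemma neg_mem_crossSphere (e : ℕ → E) (k : ℕ) {x : E} (hx : x ∈ crossSphere e k) :
    -x ∈ crossSphere e k := by
  induction k generalizing x with
  | zero =>
    rcases hx with rfl | rfl
    · right; rfl
    · left; simp
  | succ k ih =>
    obtain ⟨⟨y, t⟩, ⟨hy, ht1, ht2⟩, rfl⟩ := hx
    refine ⟨(-y, -t), ⟨ih hy, by simpa using ht2, by simpa using neg_le_neg ht1⟩, ?_⟩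
    simp only [abs_neg, smul_neg, neg_smul]
    abel

lemma combination_mem_crossSphere (e : ℕ → E) (k : ℕ) {x : E} (hx : x ∈ crossSphere e k) {t : ℝ}
    (h0 : 0 ≤ t) (h1 : t ≤ 1) : (1 - t) • x + t • e (k + 1) ∈ crossSphere e (k + 1) :=
  ⟨(x, t), ⟨hx, by simpa using by linarith, h1⟩, by simp [abs_of_nonneg h0]⟩

lemma crossSphere_subset_span (e : ℕ → E) (k : ℕ) :
    crossSphere e k ⊆ Submodule.span ℝ (e '' Set.Iic k) := by
  induction k with
  | zero =>
    have : e 0 ∈ Submodule.span ℝ (e '' Set.Iic 0) := Submodule.subset_span ⟨0, by simp, rfl⟩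
    rintro x (rfl | rfl)
    · exact this
    · exact neg_mem this
  | succ k ih =>
    rintro x ⟨⟨y, t⟩, ⟨hy, -⟩, rfl⟩
    refine add_mem (Submodule.smul_mem _ _ ?_) (Submodule.smul_mem _ _ ?_)
    · exact Submodule.span_mono (Set.image_mono (Set.Iic_subset_Iic.2 k.le_succ)) (ih hy)
    · exact Submodule.subset_span ⟨k + 1, by simp, rfl⟩

lemma ne_zero_of_mem_crossSphere {e : ℕ → E} (he : LinearIndependent ℝ e) (k : ℕ) {x : E}
    (hx : x ∈ crossSphere e k) : x ≠ 0 := by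
  induction k generalizing x with
  | zero =>
    rcases hx with rfl | rfl
    · exact he.ne_zero 0
    · exact neg_ne_zero.2 (he.ne_zero 0)
  | succ k ih =>
    obtain ⟨⟨y, t⟩, ⟨hy, -⟩, rfl⟩ := hx
    intro h
    simp only at h hy
    rcases eq_or_ne t 0 with rfl | ht
    · exact ih hy (by simpa using h)
    · have hmem : t • e (k + 1) ∈ Submodule.span ℝ (e '' Set.Iic k) := by
        rw [eq_neg_of_add_eq_zero_right h]
        exact neg_mem (Submodule.smul_mem _ _ (crossSphere_subset_span e k hy))
      rw [Submodule.smul_mem_iff _ ht] at hmem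
      exact he.notMem_span_image (by simp) hmem

/-- A mod 2 chain on sequences of `η`-close points of `crossSphere e k` that behaves like a
hemisphere: it pairs to one with the `k`-fold cup product, and the sum with its antipode is a
cycle. -/
lemma exists_hemisphere {e : ℕ → E} (s : ℕ → E → ZMod 2)
    (hs : ∀ k, ∀ x ∈ crossSphere e k, ∀ i, s i (-x) = s i x + 1) (k : ℕ) (η : ℝ) (hη : 0 < η) :
    ∃ h : (List E → ZMod 2) → ZMod 2,
      (∀ φ ψ, h (fun l => φ l + ψ l) = h φ + h ψ) ∧
      (∀ φ, (∀ l, (∀ x ∈ l, x ∈ crossSphere e k) → (∀ x ∈ l, ∀ y ∈ l, dist x y ≤ η) →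
        φ l = 0) → h φ = 0) ∧
      (∀ φ, h (fun l => cobd l φ) + h (fun l => cobd (l.map Neg.neg) φ) = 0) ∧
      h (cupCobd s k) = 1 := by
  induction k generalizing η with
  | zero =>
    refine ⟨fun φ => φ [e 0], fun _ _ => rfl, fun φ hφ => hφ _ ?_ ?_, fun φ => ?_, ?_⟩
    · simp [crossSphere]
    · simp [hη.le]
    · simp [cobd, zmod_two_add_self]
    · simp [cupCobd]
  | succ k ih =>
    obtain ⟨h, hadd, hsupp, hcyc, hone⟩ := ih (η / 2) (half_pos hη)
    obtain ⟨M, hM⟩ := (isCompact_crossSphere e k).isBounded.exists_norm_le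
    obtain ⟨m, hm⟩ := exists_nat_gt ((M + ‖e (k + 1)‖) / (η / 2))
    let g : ℕ → E → E := fun j x =>
      (1 - (j : ℝ) / (m + 1)) • x + ((j : ℝ) / (m + 1)) • e (k + 1)
    let P : (List E → ZMod 2) → List E → ZMod 2 := fun φ l =>
      ∑ j ∈ Finset.range (m + 1), prism (g j) (g (j + 1)) l φ
    let h2 : (List E → ZMod 2) → ZMod 2 := fun φ => h φ + h (fun l => φ (l.map Neg.neg))
    have hm1 : (0 : ℝ) < m + 1 := by positivity
    have h2add : ∀ φ ψ, h2 (fun l => φ l + ψ l) = h2 φ + h2 ψ := fun φ ψ => by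
      simp only [h2]
      rw [hadd φ ψ, hadd (fun l => φ (l.map Neg.neg)) (fun l => ψ (l.map Neg.neg))]
      ring
    have h2supp : ∀ φ, (∀ l, (∀ x ∈ l, x ∈ crossSphere e k) →
        (∀ x ∈ l, ∀ y ∈ l, dist x y ≤ η / 2) → φ l = 0) → h2 φ = 0 := by
      intro φ hφ
      simp only [h2]
      rw [hsupp φ hφ, hsupp _, add_zero]
      intro l hl hl'
      apply hφ
      · intro x hx
        obtain ⟨y, hy, rfl⟩ := List.mem_map.1 hx
        exact neg_mem_crossSphere e k (hl y hy)
      · intro x hx y hy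
        obtain ⟨x', hx', rfl⟩ := List.mem_map.1 hx
        obtain ⟨y', hy', rfl⟩ := List.mem_map.1 hy
        rw [dist_neg_neg]
        exact hl' x' hx' y' hy'
    have hg0 : ∀ l : List E, l.map (g 0) = l := fun l => by simp [g]
    have hgm : ∀ l : List E, (l.map Neg.neg).map (g (m + 1)) = l.map (g (m + 1)) := fun l => by
      have : ∀ x, g (m + 1) x = e (k + 1) := fun x => by
        simp only [g, Nat.cast_add, Nat.cast_one, div_self hm1.ne']
        simp
      simp [this]
    have hbd : ∀ φ, h2 (P fun l => cobd l φ) = h2 φ := by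
      intro φ
      have key : (P fun l => cobd l φ) =
          fun l => φ l + (φ (l.map (g (m + 1))) + cobd l (P φ)) := by
        funext l
        have := sum_prism g (m + 1) l φ
        rw [hg0] at this
        linear_combination this - zmod_two_add_self (cobd l (P φ))
      rw [key, h2add φ, h2add (fun l => φ (l.map (g (m + 1))))]
      have e1 : h2 (fun l => φ (l.map (g (m + 1)))) = 0 := by
        simp only [h2, hgm, zmod_two_add_self]
      have e2 : h2 (fun l => cobd l (P φ)) = 0 := hcyc (P φ)
      rw [e1, e2, add_zero, add_zero]
    refine ⟨fun φ => h2 (P φ), fun φ ψ => ?_, fun φ hφ => h2supp _ fun l hl hl' => ?_,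
      fun φ => ?_, ?_⟩
    · have e1 : P (fun l => φ l + ψ l) = fun l => P φ l + P ψ l := by
        funext l
        simp only [P, prism_add, Finset.sum_add_distrib]
      simp only [e1, h2add]
    · refine Finset.sum_eq_zero fun j hj => prism_eq_zero _ _ _ _ fun l' h' => ?_
      have hj : j + 1 ≤ m + 1 := Finset.mem_range.1 hj
      have hj' : ((j : ℝ) + 1) ≤ m + 1 := by exact_mod_cast hj
      have hmem : ∀ y ∈ l', ∃ x ∈ l, ∃ t : ℝ, t ∈ Set.Icc ((j : ℝ) / (m + 1))
          (((j : ℝ) + 1) / (m + 1)) ∧ y = (1 - t) • x + t • e (k + 1) := by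
        intro y hy
        have hle : (j : ℝ) / (m + 1) ≤ (j + 1) / (m + 1) := by gcongr; linarith
        obtain ⟨x, hx, rfl | rfl⟩ := h' y hy
        · exact ⟨x, hx, _, ⟨le_rfl, hle⟩, rfl⟩
        · exact ⟨x, hx, _, ⟨hle, le_rfl⟩, by simp [g]⟩
      have hI : ∀ t : ℝ, t ∈ Set.Icc ((j : ℝ) / (m + 1)) (((j : ℝ) + 1) / (m + 1)) →
          0 ≤ t ∧ t ≤ 1 := fun t ht =>
        ⟨le_trans (by positivity) ht.1, ht.2.trans ((div_le_one hm1).2 hj')⟩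
      refine hφ l' (fun y hy => ?_) fun y hy y' hy' => ?_
      · obtain ⟨x, hx, t, ht, rfl⟩ := hmem y hy
        exact combination_mem_crossSphere e k (hl x hx) (hI t ht).1 (hI t ht).2
      · obtain ⟨x, hx, t, ht, rfl⟩ := hmem y hy
        obtain ⟨x', hx', t', ht', rfl⟩ := hmem y' hy'
        have hd := hl' x hx x' hx'
        have htt : |t' - t| ≤ 1 / (m + 1) := by
          have : ((j : ℝ) + 1) / (m + 1) = j / (m + 1) + 1 / (m + 1) := add_div _ _ _
          rw [abs_le]
          constructor <;> linarith [ht.1, ht.2, ht'.1, ht'.2]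
        have hsmall : 1 / ((m : ℝ) + 1) * (M + ‖e (k + 1)‖) ≤ η / 2 := by
          rw [div_lt_iff₀ (half_pos hη)] at hm
          rw [one_div, inv_mul_le_iff₀ hm1]
          nlinarith
        have hx'M : ‖x' - e (k + 1)‖ ≤ M + ‖e (k + 1)‖ :=
          (norm_sub_le _ _).trans (by gcongr; exact hM x' (hl x' hx'))
        rw [dist_eq_norm] at hd ⊢
        have : (1 - t) • x + t • e (k + 1) - ((1 - t') • x' + t' • e (k + 1)) =
            (1 - t) • (x - x') + (t' - t) • (x' - e (k + 1)) := by
          module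
        rw [this]
        calc _ ≤ ‖(1 - t) • (x - x')‖ + ‖(t' - t) • (x' - e (k + 1))‖ := norm_add_le _ _
          _ = |1 - t| * ‖x - x'‖ + |t' - t| * ‖x' - e (k + 1)‖ := by
            simp only [norm_smul, Real.norm_eq_abs]
          _ ≤ 1 * (η / 2) + 1 / ((m : ℝ) + 1) * (M + ‖e (k + 1)‖) := by
            gcongr
            rw [abs_le]
            constructor <;> linarith [(hI t ht).1, (hI t ht).2]
          _ ≤ η := by linarith
    · have e1 : (fun l : List E => cobd (l.map Neg.neg) φ) =
          fun l => cobd l (fun l' => φ (l'.map Neg.neg)) := funext fun l => cobd_map _ _ _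
      simp only [e1, hbd]
      simp only [h2, List.map_map]
      have e2 : (fun l : List E => φ (l.map (Neg.neg ∘ Neg.neg))) = φ := by
        funext l; simp
      rw [e2]
      linear_combination zmod_two_add_self (h φ + h (fun l => φ (l.map Neg.neg)))
    · have e1 : cupCobd s (k + 1) = fun l => cobd l (zeroCup s k) :=
        funext fun l => (cobd_zeroCup s k l).symm
      simp only [e1, hbd]
      rw [← hone]
      simp only [h2]
      rw [← hadd]
      have e3 : h (fun l => (zeroCup s k l + zeroCup s k (l.map Neg.neg)) + cupCobd s k l) = 0 :=
        hsupp _ fun l hl _ => by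
          rw [zeroCup_map s _ k l fun x hx => hs k x (hl x hx), zmod_two_add_self]
      rw [hadd] at e3
      exact CharTwo.add_eq_zero.1 e3

/-- **Borsuk–Ulam theorem** for the boundary of a cross-polytope. -/
theorem exists_common_zero_of_odd {e : ℕ → E} (he : LinearIndependent ℝ e) (n : ℕ)
    (f : Fin n → E → ℝ) (hf : ∀ i, ContinuousOn (f i) (crossSphere e n))
    (hodd : ∀ i, ∀ x ≠ 0, f i (-x) = -f i x) :
    ∃ x ∈ crossSphere e n, ∀ i, f i x = 0 := by
  classical
  by_contra! hne
  let σ : E → ZMod 2 := fun x => if WellOrderingRel x (-x) then 1 else 0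
  have hσ : ∀ x ≠ 0, σ (-x) = σ x + 1 := by
    intro x hx
    have hxx : x ≠ -x := fun h => hx <| by
      have h2 : (2 : ℝ) • x = 0 := by rw [two_smul]; nth_rw 2 [h]; exact add_neg_cancel x
      simpa using h2
    simp only [σ, neg_neg]
    rcases trichotomous_of WellOrderingRel x (-x) with h | h | h
    · rw [if_pos h, if_neg (asymm h), zmod_two_add_self]
    · exact (hxx h).elim
    · rw [if_pos h, if_neg (asymm h), zero_add]
  let s : ℕ → E → ZMod 2 := fun i x =>
    if hi : i < n then
      if 0 < f ⟨i, hi⟩ x then 1 else if f ⟨i, hi⟩ x < 0 then 0 else σ x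
    else σ x
  have hs : ∀ x ≠ 0, ∀ i, s i (-x) = s i x + 1 := by
    intro x hx i
    by_cases hi : i < n
    · simp only [s, hi, dite_true, hodd _ x hx]
      rcases lt_trichotomy (f ⟨i, hi⟩ x) 0 with h | h | h
      · simp [h, not_lt_of_gt h]
      · simp [h, hσ x hx]
      · simp [h, not_lt_of_gt h, zmod_two_add_self]
    · simp only [s, hi, dite_false, hσ x hx]
  have hK := isCompact_crossSphere e n
  let F : E → Fin n → ℝ := fun x i => f i x
  have hF : ContinuousOn F (crossSphere e n) := continuousOn_pi.2 hf
  have hKne : (crossSphere e n).Nonempty := by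
    have : ∀ k, (crossSphere e k).Nonempty := by
      intro k
      induction k with
      | zero => exact ⟨e 0, Or.inl rfl⟩
      | succ k ih =>
        obtain ⟨x, hx⟩ := ih
        exact ⟨_, combination_mem_crossSphere e k hx le_rfl zero_le_one⟩
    exact this n
  obtain ⟨x₀, hx₀, hmin⟩ := hK.exists_isMinOn hKne hF.norm
  have hc : 0 < ‖F x₀‖ := by
    obtain ⟨i, hi⟩ := hne x₀ hx₀
    exact norm_pos_iff.2 fun h => hi (congrFun h i)
  obtain ⟨η, hη, hunif⟩ :=
    Metric.uniformContinuousOn_iff.1 (hK.uniformContinuousOn_of_continuous hF) _ hc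
  obtain ⟨h, -, hsupp, -, hone⟩ := exists_hemisphere s
    (fun k x hx => hs x (ne_zero_of_mem_crossSphere he k hx)) n (η / 2) (half_pos hη)
  rw [hsupp] at hone
  · exact zero_ne_one hone
  intro l hl hl'
  rcases l with _ | ⟨x, l⟩
  · exact cupCobd_nil s n
  have hx := hl x (by simp)
  obtain ⟨i, hi⟩ : ∃ i, ‖F x₀‖ ≤ |f i x| := by
    by_contra! hcon
    exact absurd ((pi_norm_lt_iff hc).2 hcon) (not_lt.2 (hmin hx))
  refine cupCobd_eq_zero s n i i.2 _ ?_
  have hsx : ∀ y ∈ x :: l, s i y = s i x := by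
    intro y hy
    have h1 := hunif y (hl y hy) x hx
      (lt_of_le_of_lt (hl' y hy x (by simp)) (half_lt_self hη))
    have h2 : |f i y - f i x| < |f i x| :=
      lt_of_lt_of_le (lt_of_le_of_lt (dist_le_pi_dist (F y) (F x) i) h1) hi
    simp only [s, i.2, dite_true, Fin.eta]
    rcases le_or_gt 0 (f i x) with h3 | h3
    · rw [abs_of_nonneg h3, abs_lt] at h2
      rw [if_pos (by linarith), if_pos (by linarith)]
    · rw [abs_of_neg h3, abs_lt] at h2
      rw [if_neg (by linarith), if_pos (by linarith), if_neg (by linarith), if_pos h3]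
  intro y hy z hz
  rw [hsx y hy, hsx z hz]

end BorsukUlam

section ConvexGradient

variable {H Y : Type*} [NormedAddCommGroup H] [NormedSpace ℝ H]
  [NormedAddCommGroup Y] [NormedSpace ℝ Y]

lemma ConvexOn.add_hasFDerivAt_le {f : H → ℝ} (hf : ConvexOn ℝ Set.univ f) {f' : H →L[ℝ] ℝ}
    {u : H} (hu : HasFDerivAt f f' u) (v : H) : f u + f' (v - u) ≤ f v := by
  have hline : ConvexOn ℝ Set.univ (f ∘ AffineMap.lineMap (k := ℝ) u v) :=
    hf.comp_affineMap (AffineMap.lineMap u v)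
  have hd : HasDerivAt (f ∘ AffineMap.lineMap (k := ℝ) u v) (f' (v - u)) 0 := by
    have h1 : HasFDerivAt f f' (AffineMap.lineMap (k := ℝ) u v 0) := by simpa using hu
    exact h1.comp_hasDerivAt 0 AffineMap.hasDerivAt_lineMap
  have := hline.le_slope_of_hasDerivAt (Set.mem_univ 0) (Set.mem_univ 1) zero_lt_one hd
  simp only [slope_def_field, Function.comp_apply, AffineMap.lineMap_apply_zero,
    AffineMap.lineMap_apply_one] at this
  linarith

lemma convexOn_norm_rpow (T : H →L[ℝ] Y) {p : ℝ} (hp : 1 ≤ p) :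
    ConvexOn ℝ Set.univ (fun u => ‖T u‖ ^ p) := by
  refine ⟨convex_univ, fun x _ y _ a b ha hb hab => ?_⟩
  refine le_trans ?_ ((convexOn_rpow hp).2 (norm_nonneg (T x)) (norm_nonneg (T y)) ha hb hab)
  refine Real.rpow_le_rpow (norm_nonneg _) ?_ (by linarith)
  rw [map_add, map_smul, map_smul]
  refine (norm_add_le _ _).trans_eq ?_
  simp [norm_smul, abs_of_nonneg ha, abs_of_nonneg hb]

/-- The derivative of the convex function `‖T u‖ ^ p` depends continuously on `T u`. -/
lemma exists_norm_sub_fderiv_le (T : H →L[ℝ] Y) {p : ℝ} (hp : 1 ≤ p) {D : H → H →L[ℝ] ℝ}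
    (hD : ∀ u, HasFDerivAt (fun v => ‖T v‖ ^ p) (D u) u) (u : H) {ε : ℝ} (hε : 0 < ε) :
    ∃ η > 0, ∀ v, ‖T v - T u‖ < η → ‖D v - D u‖ ≤ ε := by
  have hlin := ((hasFDerivAt_iff_isLittleO_nhds_zero.1 (hD u)).def (half_pos hε))
  obtain ⟨δ, hδ, hball⟩ := Metric.eventually_nhds_iff_ball.1 hlin
  set r := δ / 2 with hr
  have hr0 : 0 < r := half_pos hδ
  set R := ‖T u‖ + 1 + ‖T‖ * r with hR
  have hunif : UniformContinuousOn (fun x : ℝ => x ^ p) (Set.Icc 0 R) :=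
    isCompact_Icc.uniformContinuousOn_of_continuous
      (Real.continuous_rpow_const (by linarith)).continuousOn
  obtain ⟨η, hη, hη'⟩ := Metric.uniformContinuousOn_iff.1 hunif (ε * r / 4) (by positivity)
  refine ⟨min η 1, lt_min hη one_pos, fun v hv => ?_⟩
  have hvη := hv.trans_le (min_le_left _ _)
  have hv1 := hv.trans_le (min_le_right _ _)
  have hTv : ‖T v‖ ≤ ‖T u‖ + 1 := by
    have := norm_le_norm_add_norm_sub (T u) (T v)
    rw [norm_sub_rev] at this
    rw [norm_sub_rev] at hv1
    rw [norm_sub_rev] at this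
    linarith [norm_sub_rev (T u) (T v)]
  have hclose : ∀ h : H, ‖h‖ ≤ r → |‖T (v + h)‖ ^ p - ‖T (u + h)‖ ^ p| < ε * r / 4 := by
    intro h hh
    have hTh : ‖T h‖ ≤ ‖T‖ * r := (T.le_opNorm h).trans (by gcongr)
    refine hη' _ ⟨norm_nonneg _, ?_⟩ _ ⟨norm_nonneg _, ?_⟩ ?_
    · rw [map_add]; exact (norm_add_le _ _).trans (by linarith)
    · rw [map_add]; exact (norm_add_le _ _).trans (by linarith)
    · refine lt_of_le_of_lt (abs_norm_sub_norm_le _ _) ?_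
      simpa using hvη
  have key : ∀ h : H, ‖h‖ ≤ r → (D v - D u) h ≤ ε * r := by
    intro h hh
    have h1 := (convexOn_norm_rpow T hp).add_hasFDerivAt_le (hD v) (v + h)
    have h2 := hball h (by simpa using lt_of_le_of_lt hh (half_lt_self hδ))
    have h3 := abs_lt.1 (hclose h hh)
    have h4 := abs_lt.1 (hclose 0 (by simpa using hr0.le))
    rw [Real.norm_eq_abs, abs_le] at h2
    simp only [add_zero, add_sub_cancel_left] at h1 h4
    have h5 : ε / 2 * ‖h‖ ≤ ε / 2 * r := by gcongr
    rw [sub_apply]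
    linarith [h2.2, h3.2, h4.1]
  refine ContinuousLinearMap.opNorm_le_of_unit_norm hε.le fun x hx => ?_
  have hrx : ‖r • x‖ ≤ r := by rw [norm_smul, hx, mul_one, Real.norm_of_nonneg hr0.le]
  have h1 := key (r • x) hrx
  have h2 := key (-(r • x)) (by rwa [norm_neg])
  rw [map_neg, map_smul, smul_eq_mul] at h2
  rw [map_smul, smul_eq_mul] at h1
  rw [Real.norm_eq_abs, abs_le]
  constructor <;> nlinarith

lemma continuous_of_fderiv_norm_rpow (T : H →L[ℝ] Y) {p : ℝ} (hp : 1 ≤ p) {D : H → H →L[ℝ] ℝ}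
    (hD : ∀ u, HasFDerivAt (fun v => ‖T v‖ ^ p) (D u) u) {ι : Type*} {l : Filter ι} {w : ι → H}
    {u : H} (hw : Tendsto (fun i => T (w i)) l (𝓝 (T u))) :
    Tendsto (fun i => D (w i)) l (𝓝 (D u)) := by
  rw [Metric.tendsto_nhds]
  intro ε hε
  obtain ⟨η, hη, h⟩ := exists_norm_sub_fderiv_le T hp hD u (half_pos hε)
  filter_upwards [Metric.tendsto_nhds.1 hw η hη] with i hi
  rw [dist_eq_norm] at hi ⊢
  exact (h _ hi).trans_lt (half_lt_self hε)

lemma fderiv_norm_rpow_smul (T : H →L[ℝ] Y) {p : ℝ} {D : H → H →L[ℝ] ℝ}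
    (hD : ∀ u, HasFDerivAt (fun v => ‖T v‖ ^ p) (D u) u) (t : ℝ) (u : H) :
    t • D (t • u) = |t| ^ p • D u := by
  have h1 : HasFDerivAt (fun v => ‖T (t • v)‖ ^ p) (t • D (t • u)) u := by
    have := (hD (t • u)).comp u ((hasFDerivAt_id u).const_smul t)
    convert! this using 1
    ext v
    simp
  have h2 : HasFDerivAt (fun v => ‖T (t • v)‖ ^ p) (|t| ^ p • D u) u := by
    have := (hD u).const_mul (|t| ^ p)
    convert! this using 1
    funext v
    rw [map_smul, norm_smul, Real.norm_eq_abs, Real.mul_rpow (abs_nonneg _) (norm_nonneg _)]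
  exact h1.unique h2

lemma fderiv_norm_rpow_self (T : H →L[ℝ] Y) {p : ℝ} {D : H → H →L[ℝ] ℝ}
    (hD : ∀ u, HasFDerivAt (fun v => ‖T v‖ ^ p) (D u) u) (u : H) :
    D u u = p * ‖T u‖ ^ p := by
  have h1 : HasDerivAt (fun t : ℝ => ‖T (t • u)‖ ^ p) (D u u) 1 := by
    have h0 : HasFDerivAt (fun v => ‖T v‖ ^ p) (D u) ((1 : ℝ) • u) := by simpa using hD u
    have := h0.comp_hasDerivAt 1 ((hasDerivAt_id (1 : ℝ)).smul_const u)
    rwa [one_smul] at this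
  have h2 : HasDerivAt (fun t : ℝ => t ^ p * ‖T u‖ ^ p) (p * ‖T u‖ ^ p) 1 := by
    have := (Real.hasDerivAt_rpow_const (x := 1) (p := p) (Or.inl one_ne_zero)).mul_const
      (‖T u‖ ^ p)
    simpa using this
  refine (h1.congr_of_eventuallyEq ?_).unique h2
  filter_upwards [lt_mem_nhds (zero_lt_one' ℝ)] with t ht
  rw [map_smul, norm_smul, Real.norm_eq_abs, abs_of_pos ht, Real.mul_rpow ht.le (norm_nonneg _)]

end ConvexGradient

section Independence

variable {H Y : Type*} [NormedAddCommGroup H] [NormedSpace ℝ H]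
  [NormedAddCommGroup Y] [NormedSpace ℝ Y]

lemma exists_linearIndependent_nat (hinf : ¬ FiniteDimensional ℝ H) :
    ∃ e : ℕ → H, LinearIndependent ℝ e := by
  let b := Module.Basis.ofVectorSpace ℝ H
  have : Infinite (Module.Basis.ofVectorSpaceIndex ℝ H) := by
    by_contra h
    rw [not_infinite_iff_finite] at h
    exact hinf (Module.Finite.of_basis b)
  exact ⟨_, b.linearIndependent.comp _ (Infinite.natEmbedding _).injective⟩

/-- Finitely many continuous functionals have no common zero on a compact set avoiding zero. -/
lemma IsCompact.exists_dual_ne_zero {Z : Set Y} (hZ : IsCompact Z) (h0 : (0 : Y) ∉ Z) :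
    ∃ (n : ℕ) (y : Fin n → Y →L[ℝ] ℝ), ∀ z ∈ Z, ∃ i, y i z ≠ 0 := by
  obtain ⟨t, ht⟩ := hZ.elim_finite_subcover (fun y : Y →L[ℝ] ℝ => {z | y z ≠ 0})
    (fun y => isOpen_ne.preimage y.continuous) fun z hz => by
      obtain ⟨y, -, hy⟩ := exists_dual_vector ℝ z (norm_ne_zero_iff.2 fun h => h0 (h ▸ hz))
      refine Set.mem_iUnion.2 ⟨y, ?_⟩
      simpa [hy] using fun h : z = 0 => h0 (h ▸ hz)
  refine ⟨t.card, fun i => (t.equivFin.symm i : Y →L[ℝ] ℝ), fun z hz => ?_⟩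
  obtain ⟨y, hy, hyz⟩ := Set.mem_iUnion₂.1 (ht hz)
  exact ⟨t.equivFin ⟨y, hy⟩, by simpa using hyz⟩

end Independence

section Hilbert

variable {H Y : Type*} [NormedAddCommGroup H] [InnerProductSpace ℝ H] [CompleteSpace H]
  [NormedAddCommGroup Y] [NormedSpace ℝ Y]

/-- A compact operator maps every bounded sequence of a separable Hilbert space to a sequence with
a subsequence converging to a point of the range. -/
lemma IsCompactOperator.exists_subseq_tendsto [TopologicalSpace.SeparableSpace H]
    {T : H →L[ℝ] Y} (hT : IsCompactOperator T) {R : ℝ} {w : ℕ → H} (hw : ∀ n, ‖w n‖ ≤ R) :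
    ∃ u : H, ∃ φ : ℕ → ℕ, StrictMono φ ∧ Tendsto (fun n => T (w (φ n))) atTop (𝓝 (T u)) := by
  obtain ⟨ℓ, -, φ, hφ, hlim⟩ := WeakDual.isSeqCompact_closedBall ℝ H 0 R
    (x := fun n => StrongDual.toWeakDual (InnerProductSpace.toDual ℝ H (w n)))
    (fun n => by simpa using hw n)
  obtain ⟨z, -, ψ, hψ, hz⟩ := (hT.isCompact_closure_image_closedBall R).tendsto_subseq
    (x := fun n => T (w (φ n)))
    (fun n => subset_closure ⟨w (φ n), by simpa using hw (φ n), rfl⟩)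
  refine ⟨(InnerProductSpace.toDual ℝ H).symm (WeakDual.toStrongDual ℓ), φ ∘ ψ, hφ.comp hψ, ?_⟩
  convert! hz
  refine (SeparatingDual.eq_iff_forall_dual_eq (R := ℝ)).2 fun y => ?_
  have h1 : Tendsto (fun n => y (T (w (φ (ψ n))))) atTop (𝓝 (y z)) :=
    (y.continuous.tendsto z).comp hz
  refine tendsto_nhds_unique ?_ h1
  set v := (InnerProductSpace.toDual ℝ H).symm (y.comp T) with hv
  have hyT : ∀ x, y (T x) = inner ℝ x v := fun x => by
    rw [real_inner_comm, hv, InnerProductSpace.toDual_symm_apply]; rfl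
  have h2 := ((WeakDual.eval_continuous v).tendsto ℓ).comp (hlim.comp hψ.tendsto_atTop)
  simp only [hyT, InnerProductSpace.toDual_symm_apply]
  exact h2

lemma exists_riesz_of_coercive (B : H →L[ℝ] H →L[ℝ] ℝ) {c : ℝ} (hc : 0 < c)
    (hB : ∀ u, c * ‖u‖ ^ 2 ≤ B u u) :
    ∃ R : (H →L[ℝ] ℝ) →L[ℝ] H, ∀ ℓ, B (R ℓ) = ℓ := by
  have hcoer : IsCoercive B := ⟨c, hc, fun u => by
    have := hB u
    rwa [pow_two, ← mul_assoc] at this⟩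
  have hker : (B : H →ₗ[ℝ] H →L[ℝ] ℝ).ker = ⊥ := by
    refine (Submodule.eq_bot_iff _).2 fun u hu => ?_
    have hu' : B u = 0 := hu
    have h1 := hB u
    rw [hu', zero_apply] at h1
    by_contra hne
    have := norm_pos_iff.2 hne
    have : 0 < c * ‖u‖ ^ 2 := by positivity
    linarith
  have hrange : (B : H →ₗ[ℝ] H →L[ℝ] ℝ).range = ⊤ := by
    refine LinearMap.range_eq_top.2 fun ℓ =>
      ⟨hcoer.continuousLinearEquivOfBilin.symm ((InnerProductSpace.toDual ℝ H).symm ℓ), ?_⟩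
    ext v
    refine (hcoer.continuousLinearEquivOfBilin_apply _ _).symm.trans ?_
    simp
  exact ⟨(ContinuousLinearEquiv.ofBijective B hker hrange).symm,
    fun ℓ => (ContinuousLinearEquiv.ofBijective B hker hrange).apply_symm_apply ℓ⟩

end Hilbert

section EigenvalueProblem

variable {H Y : Type*} [NormedAddCommGroup H] [InnerProductSpace ℝ H]
  [NormedAddCommGroup Y] [NormedSpace ℝ Y]

/-- Radial projection onto the unit sphere of the bilinear form `B`. -/
noncomputable def formNormalize (B : H →L[ℝ] H →L[ℝ] ℝ) (u : H) : H := (√(B u u))⁻¹ • u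

lemma pos_of_coercive {B : H →L[ℝ] H →L[ℝ] ℝ} {c : ℝ} (hc : 0 < c)
    (hB : ∀ u, c * ‖u‖ ^ 2 ≤ B u u) {u : H} (hu : u ≠ 0) : 0 < B u u := by
  have := norm_pos_iff.2 hu
  exact lt_of_lt_of_le (by positivity) (hB u)

lemma formNormalize_neg (B : H →L[ℝ] H →L[ℝ] ℝ) (u : H) :
    formNormalize B (-u) = -formNormalize B u := by
  simp [formNormalize]

lemma form_formNormalize {B : H →L[ℝ] H →L[ℝ] ℝ} {u : H} (hu : 0 < B u u) :
    B (formNormalize B u) (formNormalize B u) = 1 := by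
  have h := Real.sqrt_pos.2 hu
  simp only [formNormalize, map_smul, smul_apply, smul_eq_mul]
  nth_rewrite 3 [← Real.mul_self_sqrt hu.le]
  field_simp

lemma continuousAt_formNormalize {B : H →L[ℝ] H →L[ℝ] ℝ} {u : H} (hu : 0 < B u u) :
    ContinuousAt (formNormalize B) u := by
  have hBc : Continuous fun x : H => B x x := B.continuous.clm_apply continuous_id
  exact ((Real.continuous_sqrt.comp hBc).continuousAt.inv₀ (Real.sqrt_pos.2 hu).ne').smul
    continuousAt_id

/-- The defect in the Cauchy–Schwarz inequality for `B`. -/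
lemma sqrt_form_sub_form {B : H →L[ℝ] H →L[ℝ] ℝ} (hs : ∀ u v, B u v = B v u) {w u : H}
    (hw : 0 < B w w) (hu : B u u = 1) :
    √(B w w) - B w u =
      √(B w w) * B (formNormalize B w - u) (formNormalize B w - u) / 2 := by
  have h := Real.sqrt_pos.2 hw
  have h1 : B (formNormalize B w - u) (formNormalize B w - u)
      = 2 - 2 * ((√(B w w))⁻¹ * B w u) := by
    have h2 := form_formNormalize hw
    simp only [map_sub, sub_apply]
    rw [h2, hu, hs u]
    simp only [formNormalize, map_smul, smul_apply, smul_eq_mul]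
    ring
  rw [h1]
  field_simp

variable {T : H →L[ℝ] Y} {p : ℝ} {D : H → H →L[ℝ] ℝ}

/-- One step of the normalized gradient iteration increases `‖T u‖ ^ p`. -/
lemma norm_rpow_add_le_formNormalize {B : H →L[ℝ] H →L[ℝ] ℝ} (hs : ∀ u v, B u v = B v u)
    (hp : 1 ≤ p) (hD : ∀ u, HasFDerivAt (fun v => ‖T v‖ ^ p) (D u) u) {w u : H}
    (hDw : D u = p • B w) (hw : 0 < B w w) (hu : B u u = 1) :
    ‖T u‖ ^ p + p * (√(B w w) * B (formNormalize B w - u) (formNormalize B w - u) / 2) ≤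
      ‖T (formNormalize B w)‖ ^ p := by
  have h := Real.sqrt_pos.2 hw
  have h1 := (convexOn_norm_rpow T hp).add_hasFDerivAt_le (hD u) (formNormalize B w)
  have h2 : B w (formNormalize B w) = √(B w w) := by
    simp only [formNormalize, map_smul, smul_eq_mul]
    nth_rewrite 2 [← Real.mul_self_sqrt hw.le]
    field_simp
  rw [hDw, smul_apply, map_sub, h2, sqrt_form_sub_form hs hw hu, smul_eq_mul] at h1
  exact h1

variable [CompleteSpace H] [TopologicalSpace.SeparableSpace H]

/-- If the normalized gradient iteration has no uniform gain on a level strip, then the strip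
contains a solution of the eigenvalue problem. -/
lemma exists_gain_or_exists_eigenvector (hT : IsCompactOperator T) (hTi : Function.Injective T)
    {B : H →L[ℝ] H →L[ℝ] ℝ} (hs : ∀ u v, B u v = B v u) {c : ℝ} (hc : 0 < c)
    (hB : ∀ u, c * ‖u‖ ^ 2 ≤ B u u) (hp : 1 ≤ p)
    (hD : ∀ u, HasFDerivAt (fun v => ‖T v‖ ^ p) (D u) u) {K : H → H}
    (hK : ∀ u, D u = p • B (K u))
    (hKT : ∀ (w : ℕ → H) (u : H), Tendsto (fun n => T (w n)) atTop (𝓝 (T u)) →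
      Tendsto (fun n => K (w n)) atTop (𝓝 (K u)))
    {δ E : ℝ} (hδ : 0 < δ) :
    (∃ η > 0, ∀ u, B u u = 1 → δ ≤ ‖T u‖ ^ p → ‖T u‖ ^ p ≤ E →
      ‖T u‖ ^ p + η ≤ ‖T (formNormalize B (K u))‖ ^ p) ∨
    ∃ u, B u u = 1 ∧ δ ≤ ‖T u‖ ^ p ∧ ‖T u‖ ^ p ≤ E ∧ D u = (p * ‖T u‖ ^ p) • B u := by
  have hp0 : 0 < p := by linarith
  have hKu : ∀ u, B (K u) u = ‖T u‖ ^ p := fun u => by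
    have h := fderiv_norm_rpow_self T hD u
    rw [hK, smul_apply, smul_eq_mul] at h
    exact mul_left_cancel₀ hp0.ne' h
  have hpos : ∀ u, δ ≤ ‖T u‖ ^ p → 0 < B (K u) (K u) := fun u hu => by
    refine pos_of_coercive hc hB fun h => ?_
    have := hKu u
    rw [h, map_zero, zero_apply] at this
    linarith
  refine or_iff_not_imp_left.2 fun hno => ?_
  push Not at hno
  choose w hw1 hwδ hwE hgain using fun n : ℕ => hno (1 / ((n : ℝ) + 1)) Nat.one_div_pos_of_nat
  have hbound : ∀ n, ‖w n‖ ≤ √(1 / c) := fun n => by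
    refine Real.le_sqrt_of_sq_le ?_
    rw [le_div_iff₀ hc, mul_comm, ← hw1 n]
    exact hB _
  obtain ⟨u, φ, hφ, hlim⟩ := hT.exists_subseq_tendsto hbound
  have hJlim : Tendsto (fun n => ‖T (w (φ n))‖ ^ p) atTop (𝓝 (‖T u‖ ^ p)) :=
    hlim.norm.rpow_const (Or.inr hp0.le)
  have huδ : δ ≤ ‖T u‖ ^ p := ge_of_tendsto' hJlim fun n => hwδ _
  have huE : ‖T u‖ ^ p ≤ E := le_of_tendsto' hJlim fun n => hwE _
  have hψ : Tendsto (fun n => formNormalize B (K (w (φ n)))) atTop (𝓝 (formNormalize B (K u))) :=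
    (continuousAt_formNormalize (hpos u huδ)).tendsto.comp (hKT _ _ hlim)
  have hdist : Tendsto (fun n => formNormalize B (K (w (φ n))) - w (φ n)) atTop (𝓝 0) := by
    have hsmall : Tendsto (fun n => 2 / (p * δ * c) * (1 / ((φ n : ℝ) + 1))) atTop (𝓝 0) := by
      have h0 := (tendsto_one_div_add_atTop_nhds_zero_nat (𝕜 := ℝ)).comp hφ.tendsto_atTop
      simpa using h0.const_mul (2 / (p * δ * c))
    have hsq : Tendsto (fun n => ‖formNormalize B (K (w (φ n))) - w (φ n)‖ ^ 2) atTop (𝓝 0) := by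
      refine squeeze_zero (fun n => by positivity) (fun n => ?_) hsmall
      set d := formNormalize B (K (w (φ n))) - w (φ n) with hd
      have h1 := norm_rpow_add_le_formNormalize hs hp hD (hK (w (φ n))) (hpos _ (hwδ (φ n)))
        (hw1 (φ n))
      have h2 := sqrt_form_sub_form hs (hpos _ (hwδ (φ n))) (hw1 (φ n))
      have h3 := hgain (φ n)
      have h4 := hwδ (φ n)
      rw [hKu] at h2
      rw [← hd] at h1 h2
      have h5 : c * ‖d‖ ^ 2 ≤ B d d := hB d
      have h6 : 0 ≤ B d d := le_trans (by positivity) h5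
      have h7 : δ ≤ √(B (K (w (φ n))) (K (w (φ n)))) := by
        have := Real.sqrt_nonneg (B (K (w (φ n))) (K (w (φ n))))
        have : 0 ≤ √(B (K (w (φ n))) (K (w (φ n)))) * B d d / 2 := by positivity
        linarith
      have h8 : p * (δ * (c * ‖d‖ ^ 2) / 2) ≤
          p * (√(B (K (w (φ n))) (K (w (φ n)))) * B d d / 2) := by gcongr
      rw [div_mul_eq_mul_div, le_div_iff₀ (by positivity)]
      linarith
    rw [tendsto_zero_iff_norm_tendsto_zero]
    have := hsq.sqrt
    simpa [Real.sqrt_sq] using this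
  have hwlim : Tendsto (fun n => w (φ n)) atTop (𝓝 (formNormalize B (K u))) := by
    simpa using hψ.sub hdist
  have hu : formNormalize B (K u) = u :=
    hTi (tendsto_nhds_unique ((T.continuous.tendsto _).comp hwlim) hlim)
  have hN := Real.sqrt_pos.2 (hpos u huδ)
  have hKeq : K u = √(B (K u) (K u)) • u := by
    nth_rewrite 4 [← hu]
    rw [formNormalize, smul_inv_smul₀ hN.ne']
  have hu1 : B u u = 1 := by
    have := form_formNormalize (hpos u huδ)
    rwa [hu] at this
  have hNJ : √(B (K u) (K u)) = ‖T u‖ ^ p := by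
    have h := hKu u
    rw [hKeq, map_smul, smul_apply, hu1, smul_eq_mul, mul_one] at h
    exact h
  refine ⟨u, hu1, huδ, huE, ?_⟩
  rw [hK, mul_smul]
  congr 1
  rw [hKeq, hNJ, map_smul]

/-- The nonlinear eigenvalue problem `D u = λ B u`, where `D` is the derivative of `‖T u‖ ^ p`, has
normalized solutions at arbitrarily small levels of `‖T u‖ ^ p`. -/
theorem exists_eigenvector_norm_rpow_lt (hinf : ¬ FiniteDimensional ℝ H)
    (hT : IsCompactOperator T) (hTi : Function.Injective T)
    {B : H →L[ℝ] H →L[ℝ] ℝ} (hs : ∀ u v, B u v = B v u) {c : ℝ} (hc : 0 < c)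
    (hB : ∀ u, c * ‖u‖ ^ 2 ≤ B u u) (hp : 1 ≤ p)
    (hD : ∀ u, HasFDerivAt (fun v => ‖T v‖ ^ p) (D u) u) {ε : ℝ} (hε : 0 < ε) :
    ∃ u, B u u = 1 ∧ 0 < ‖T u‖ ^ p ∧ ‖T u‖ ^ p < ε ∧ D u = (p * ‖T u‖ ^ p) • B u := by
  have hp0 : 0 < p := by linarith
  by_contra hno
  push Not at hno
  obtain ⟨R, hR⟩ := exists_riesz_of_coercive B hc hB
  set K : H → H := fun u => R (p⁻¹ • D u) with hKdef
  have hK : ∀ u, D u = p • B (K u) := fun u => by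
    rw [hKdef, hR, smul_inv_smul₀ hp0.ne']
  have hKT : ∀ u, Tendsto K (comap T (𝓝 (T u))) (𝓝 (K u)) := fun u =>
    (R.continuous.tendsto _).comp
      ((continuous_of_fderiv_norm_rpow T hp hD tendsto_comap).const_smul p⁻¹)
  have hKneg : ∀ u, K (-u) = -K u := fun u => by
    have h := fderiv_norm_rpow_smul T hD (-1) u
    have h' : D (-u) = -D u := by
      ext v
      have := DFunLike.congr_fun h v
      simp only [neg_smul, one_smul, abs_neg, abs_one, Real.one_rpow, smul_apply,
        smul_eq_mul, neg_mul, one_mul] at this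
      rw [neg_apply]
      linarith
    simp only [hKdef, h', smul_neg, map_neg]
  have hKcont : Continuous K := continuous_iff_continuousAt.2 fun u =>
    (hKT u).mono_left (T.continuous.tendsto u).le_comap
  have hJpos : ∀ u, u ≠ 0 → 0 < ‖T u‖ ^ p := fun u hu =>
    Real.rpow_pos_of_pos (norm_pos_iff.2 ((map_ne_zero_iff T hTi).2 hu)) p
  have hBpos : ∀ u, u ≠ 0 → 0 < B u u := fun u hu => pos_of_coercive hc hB hu
  have hne : ∀ u, B u u = 1 → u ≠ 0 := by
    rintro u hu rfl
    simp at hu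
  have hKne : ∀ u, u ≠ 0 → K u ≠ 0 := fun u hu h => by
    have h1 := fderiv_norm_rpow_self T hD u
    rw [hK, h, map_zero, smul_zero, zero_apply] at h1
    have := mul_pos hp0 (hJpos u hu)
    linarith
  set Ψ : H → H := fun u => formNormalize B (K u) with hΨ
  have hΨ1 : ∀ u, u ≠ 0 → B (Ψ u) (Ψ u) = 1 := fun u hu =>
    form_formNormalize (hBpos _ (hKne u hu))
  have hΨmaps : Set.MapsTo Ψ {0}ᶜ {0}ᶜ := fun u hu => hne _ (hΨ1 u hu)
  have hgcont : ContinuousOn (formNormalize B) {0}ᶜ := fun u hu =>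
    (continuousAt_formNormalize (hBpos u hu)).continuousWithinAt
  have hΨcont : ContinuousOn Ψ {0}ᶜ := hgcont.comp hKcont.continuousOn fun u hu => hKne u hu
  have hΨneg : ∀ m u, Ψ^[m] (-u) = -Ψ^[m] u := fun m u => by
    have : Function.Commute Ψ Neg.neg := fun u => by
      rw [hΨ]
      simp only [hKneg, formNormalize_neg]
    exact (this.iterate_left m) u
  have hmono : ∀ u, B u u = 1 → ‖T u‖ ^ p ≤ ‖T (Ψ u)‖ ^ p := fun u hu => by
    refine le_trans ?_ (norm_rpow_add_le_formNormalize hs hp hD (hK u)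
      (hBpos _ (hKne u (hne u hu))) hu)
    have h1 : ∀ x, 0 ≤ B x x := fun x => le_trans (by positivity) (hB x)
    have h2 := h1 (formNormalize B (K u) - u)
    have : 0 ≤ p * (√(B (K u) (K u)) * B (formNormalize B (K u) - u)
      (formNormalize B (K u) - u) / 2) := by positivity
    linarith
  set Z : Set Y := closure (T '' Metric.closedBall 0 √(1 / c)) ∩ {z | ε / 2 ≤ ‖z‖ ^ p} with hZ
  have hZc : IsCompact Z := (hT.isCompact_closure_image_closedBall _).inter_right
    (isClosed_le continuous_const (continuous_norm.rpow_const fun _ => Or.inr hp0.le))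
  have hZ0 : (0 : Y) ∉ Z := fun h => by
    have h1 : ε / 2 ≤ ‖(0 : Y)‖ ^ p := h.2
    rw [norm_zero, Real.zero_rpow hp0.ne'] at h1
    linarith
  obtain ⟨n, y, hy⟩ := hZc.exists_dual_ne_zero hZ0
  obtain ⟨e, he⟩ := exists_linearIndependent_nat hinf
  have hsub : crossSphere e n ⊆ {0}ᶜ := fun x hx => ne_zero_of_mem_crossSphere he n hx
  have hJcont : ContinuousOn (fun x => ‖T (formNormalize B x)‖ ^ p) (crossSphere e n) :=
    ((T.continuous.comp_continuousOn (hgcont.mono hsub)).norm).rpow_const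
      fun _ _ => Or.inr hp0.le
  have hg1 : ∀ x ∈ crossSphere e n, B (formNormalize B x) (formNormalize B x) = 1 :=
    fun x hx => form_formNormalize (hBpos x (hsub hx))
  obtain ⟨δ, hδ, hδle⟩ : ∃ δ > 0, ∀ x ∈ crossSphere e n, δ ≤ ‖T (formNormalize B x)‖ ^ p := by
    rcases (crossSphere e n).eq_empty_or_nonempty with h | h
    · exact ⟨1, one_pos, by simp [h]⟩
    · obtain ⟨x, hx, hmin⟩ := (isCompact_crossSphere e n).exists_isMinOn h hJcont
      exact ⟨_, hJpos _ (hne _ (hg1 x hx)), fun x' hx' => hmin hx'⟩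
  obtain ⟨η, hη, hgain⟩ : ∃ η > 0, ∀ u, B u u = 1 → δ ≤ ‖T u‖ ^ p → ‖T u‖ ^ p ≤ ε / 2 →
      ‖T u‖ ^ p + η ≤ ‖T (Ψ u)‖ ^ p := by
    refine (exists_gain_or_exists_eigenvector hT hTi hs hc hB hp hD hK 
      (fun w u h => (hKT u).comp (tendsto_comap_iff.2 h))
      hδ).resolve_right ?_
    rintro ⟨u, hu1, huδ, huE, hu⟩
    exact hno u hu1 (hδ.trans_le huδ) (by linarith) hu
  have hiter : ∀ x ∈ crossSphere e n, ∀ m : ℕ,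
      B (Ψ^[m] (formNormalize B x)) (Ψ^[m] (formNormalize B x)) = 1 ∧
      δ ≤ ‖T (Ψ^[m] (formNormalize B x))‖ ^ p ∧
      min (ε / 2) (m * η) ≤ ‖T (Ψ^[m] (formNormalize B x))‖ ^ p := by
    intro x hx m
    induction m with
    | zero =>
      refine ⟨hg1 x hx, hδle x hx, ?_⟩
      simp only [Nat.cast_zero, zero_mul, Function.iterate_zero, id]
      exact (min_le_right _ _).trans (hδ.le.trans (hδle x hx))
    | succ m ih =>
      obtain ⟨h1, h2, h3⟩ := ih
      rw [Function.iterate_succ_apply']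
      set v := Ψ^[m] (formNormalize B x)
      refine ⟨hΨ1 v (hne v h1), h2.trans (hmono v h1), ?_⟩
      rcases le_total (‖T v‖ ^ p) (ε / 2) with h | h
      · have h4 := hgain v h1 h2 h
        rcases min_le_iff.1 h3 with h5 | h5
        · exact (min_le_left _ _).trans (by linarith)
        · refine (min_le_right _ _).trans ?_
          push_cast
          linarith
      · exact (min_le_left _ _).trans (h.trans (hmono v h1))
  obtain ⟨m, hm⟩ := exists_nat_ge (ε / 2 / η)
  rw [div_le_iff₀ hη] at hm
  obtain ⟨x, hx, hx0⟩ := exists_common_zero_of_odd he n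
    (fun i x => y i (T (Ψ^[m] (formNormalize B x))))
    (fun i => (y i).continuous.comp_continuousOn (T.continuous.comp_continuousOn
      ((hΨcont.iterate hΨmaps m).comp (hgcont.mono hsub)
        fun x hx => hne _ (hg1 x hx))))
    (fun i x _ => by simp only [formNormalize_neg, hΨneg, map_neg])
  obtain ⟨h1, -, h3⟩ := hiter x hx m
  rw [min_eq_left hm] at h3
  have hball : Ψ^[m] (formNormalize B x) ∈ Metric.closedBall 0 √(1 / c) := by
    rw [mem_closedBall_zero_iff]
    refine Real.le_sqrt_of_sq_le ?_
    rw [le_div_iff₀ hc, mul_comm, ← h1]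
    exact hB _
  obtain ⟨i, hi⟩ := hy _ ⟨subset_closure (Set.mem_image_of_mem T hball), h3⟩
  exact hi (hx0 i)

/-- Rescaling the normalized solutions of the eigenvalue problem removes the multiplier. -/
theorem exists_fderiv_norm_rpow_eq_form (hinf : ¬ FiniteDimensional ℝ H)
    (hT : IsCompactOperator T) (hTi : Function.Injective T)
    {B : H →L[ℝ] H →L[ℝ] ℝ} (hs : ∀ u v, B u v = B v u) {c : ℝ} (hc : 0 < c)
    (hB : ∀ u, c * ‖u‖ ^ 2 ≤ B u u) (hp : 2 < p)
    (hD : ∀ u, HasFDerivAt (fun v => ‖T v‖ ^ p) (D u) u) {M : ℝ} (hM : 0 < M) :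
    ∃ u, u ≠ 0 ∧ D u = p • B u ∧ M ≤ ‖T u‖ ^ p := by
  have hp2 : 0 < p - 2 := by linarith
  obtain ⟨w, hw1, hκ, hκε, hw⟩ := exists_eigenvector_norm_rpow_lt hinf hT hTi hs hc hB
    (by linarith) hD (Real.rpow_pos_of_pos hM (-((p - 2) / 2)))
  set κ := ‖T w‖ ^ p with hκdef
  set t := κ ^ (-(1 / (p - 2))) with ht
  have ht0 : 0 < t := Real.rpow_pos_of_pos hκ _
  have htκ : t ^ p * κ = t ^ 2 := by
    have h1 : t ^ (p - 2) * κ = 1 := by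
      rw [ht, ← Real.rpow_mul hκ.le, neg_mul, one_div_mul_cancel hp2.ne', Real.rpow_neg_one,
        inv_mul_cancel₀ hκ.ne']
    have h2 : t ^ p = t ^ (p - 2) * t ^ 2 := by
      rw [← Real.rpow_natCast, ← Real.rpow_add ht0]
      norm_num
    rw [h2]
    linear_combination t ^ 2 * h1
  have hw0 : w ≠ 0 := by
    rintro rfl
    simp at hw1
  refine ⟨t • w, smul_ne_zero ht0.ne' hw0, ?_, ?_⟩
  · ext v
    have h := DFunLike.congr_fun (fderiv_norm_rpow_smul T hD t w) v
    rw [hw, abs_of_pos ht0] at h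
    simp only [smul_apply, smul_eq_mul, map_smul] at h ⊢
    refine mul_left_cancel₀ ht0.ne' ?_
    linear_combination h + p * B w v * htκ
  · rw [map_smul, norm_smul, Real.norm_of_nonneg ht0.le, Real.mul_rpow ht0.le (norm_nonneg _),
      ← hκdef, htκ, ht, ← Real.rpow_natCast, ← Real.rpow_mul hκ.le]
    calc M = (M ^ (-((p - 2) / 2))) ^ (-(1 / (p - 2)) * (2 : ℕ)) := by
          rw [← Real.rpow_mul hM.le]
          have : -((p - 2) / 2) * (-(1 / (p - 2)) * (2 : ℕ)) = 1 := by
            push_cast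
            field_simp
          rw [this, Real.rpow_one]
      _ ≤ κ ^ (-(1 / (p - 2)) * (2 : ℕ)) := by
          refine Real.rpow_le_rpow_of_nonpos hκ hκε.le ?_
          have : 0 < 1 / (p - 2) := by positivity
          push_cast
          linarith

end EigenvalueProblem

lemma integral_abs_rpow_eq_norm_rpow {Ω : Type*} [MeasurableSpace Ω] {μ : Measure Ω} {p : ℝ}
    (hp : 0 < p) (f : Lp ℝ (ENNReal.ofReal p) μ) : ∫ x, |f x| ^ p ∂μ = ‖f‖ ^ p := by
  have h := (Lp.memLp f).eLpNorm_eq_integral_rpow_norm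
    (by simpa using hp) ENNReal.ofReal_ne_top
  have h0 : 0 ≤ ∫ x, ‖f x‖ ^ p ∂μ := integral_nonneg fun x => by positivity
  rw [ENNReal.toReal_ofReal hp.le] at h
  rw [Lp.norm_def, h, ENNReal.toReal_ofReal (by positivity), ← Real.rpow_mul h0,
    inv_mul_cancel₀ hp.ne', Real.rpow_one]
  rfl

/-- (Abstract core of Theorem 1.1 of the paper.) On an
infinite-dimensional separable real Hilbert space `H`, the abstract Yamabe-type functional
`I(u) = ½B(u,u) - (1/(q+1)) ∫ |Tu|^{q+1} dμ` admits a sequence of nonzero critical points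
`(u_m)` with `I(u_m) → +∞`; consequently the energies `∫ |Tu_m|^{q+1} dμ` tend to `+∞`, and
`I` has infinitely many distinct nonzero critical points. -/
theorem infinitely_many_critical_points_with_large_energy
    {H : Type*} [NormedAddCommGroup H] [InnerProductSpace ℝ H] [CompleteSpace H]
    [TopologicalSpace.SeparableSpace H] (hinf : ¬ FiniteDimensional ℝ H)
    {Ω : Type*} [MeasurableSpace Ω] (μ : Measure Ω)
    (q : ℝ) (hq : 1 < q) [Fact (1 ≤ ENNReal.ofReal (q + 1))]
    (T : H →L[ℝ] Lp ℝ (ENNReal.ofReal (q + 1)) μ)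
    (hTcomp : IsCompactOperator T) (hTinj : Function.Injective T)
    (B : H →L[ℝ] H →L[ℝ] ℝ) (hBsymm : ∀ u v : H, B u v = B v u)
    (c0 : ℝ) (hc0 : 0 < c0) (hBcoer : ∀ u : H, c0 * ‖u‖ ^ 2 ≤ B u u)
    (I : H → ℝ)
    (hI : ∀ u : H, I u = (1 / 2) * B u u - (1 / (q + 1)) * ∫ x, |(T u) x| ^ (q + 1) ∂μ)
    (DI : H → (H →L[ℝ] ℝ)) (hDI : ∀ u : H, HasFDerivAt I (DI u) u) :
    ∃ u : ℕ → H,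
      (∀ m : ℕ, u m ≠ 0) ∧
      (∀ m : ℕ, DI (u m) = 0) ∧
      Tendsto (fun m => I (u m)) atTop atTop ∧
      Tendsto (fun m => ∫ x, |(T (u m)) x| ^ (q + 1) ∂μ) atTop atTop ∧
      {v : H | v ≠ 0 ∧ DI v = 0}.Infinite := by
  have hp0 : 0 < q + 1 := by linarith
  have hp2 : 2 < q + 1 := by linarith
  have hint : ∀ u, ∫ x, |(T u) x| ^ (q + 1) ∂μ = ‖T u‖ ^ (q + 1) := fun u =>
    integral_abs_rpow_eq_norm_rpow hp0 (T u)
  simp only [hint] at hI ⊢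
  have hD : ∀ u, HasFDerivAt (fun v => ‖T v‖ ^ (q + 1)) ((q + 1) • (B u - DI u)) u := fun u => by
    have hBd : HasFDerivAt (fun v => (1 / 2 : ℝ) * B v v) (B u) u := by
      have h := ((B.hasFDerivAt (x := u)).clm_apply (hasFDerivAt_id u)).const_mul (1 / 2 : ℝ)
      convert! h using 1
      ext v
      simp [hBsymm v u]
      ring
    have h := (hBd.sub (hDI u)).const_mul (q + 1)
    convert! h using 1
    funext v
    simp only [Pi.sub_apply, hI]
    field_simp
    ring
  have hcrit : ∀ u, DI u = 0 → I u = (1 / 2 - 1 / (q + 1)) * ‖T u‖ ^ (q + 1) := fun u hu => by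
    have h := fderiv_norm_rpow_self T hD u
    rw [hu, sub_zero, smul_apply, smul_eq_mul] at h
    rw [hI, mul_left_cancel₀ hp0.ne' h]
    ring
  have hlarge : ∀ m : ℕ, ∃ u, u ≠ 0 ∧ DI u = 0 ∧ (m : ℝ) ≤ ‖T u‖ ^ (q + 1) := fun m => by
    obtain ⟨u, hu0, hu, hum⟩ := exists_fderiv_norm_rpow_eq_form hinf hTcomp hTinj hBsymm hc0 hBcoer
      hp2 hD (Nat.cast_add_one_pos (α := ℝ) m)
    refine ⟨u, hu0, ?_, by linarith⟩
    have h := smul_right_injective _ hp0.ne' hu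
    simpa using h
  choose u hu0 hu hum using hlarge
  have henergy : Tendsto (fun m => ‖T (u m)‖ ^ (q + 1)) atTop atTop :=
    tendsto_atTop_mono hum tendsto_natCast_atTop_atTop
  refine ⟨u, hu0, hu, ?_, henergy, fun hfin => ?_⟩
  · simp only [hcrit _ (hu _)]
    refine henergy.const_mul_atTop ?_
    rw [sub_pos]
    exact one_div_lt_one_div_of_lt two_pos hp2
  · obtain ⟨C, hC⟩ := (hfin.image fun v => ‖T v‖ ^ (q + 1)).bddAbove
    obtain ⟨m, hm⟩ := exists_nat_gt C
    exact absurd (hC ⟨u m, ⟨hu0 m, hu m⟩, rfl⟩) (not_le.2 (hm.trans_le (hum m)))
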